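/- arXiv:1810.09021 — 6 statements merged into one kernel-verified Lean document; each statement's English description precedes it below -/
import Mathlib

section
/- Equivalence Lemma: Let m : M¹ → M² and n : N¹ → N² be chain maps between cochain complexes of k-modules that are homotopy equivalences, and let μ = (μ¹, μ⁰, μ²) be a closed degree-0 triple morphism from (M¹, m, M²) to (N¹, n, N²). Then μ is a homotopy equivalence in the triple category if and only if μ¹ and μ² are homotopy equivalences of complexes and n ∘ μ¹ is homotopic to μ² ∘ m (the latter condition being automatic from closedness of μ). -/
namespace ThesisDG

universe u

/-- A `ℤ`-indexed family of `k`-modules together with maps `d i j` (morally supported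
on `j = i + 1`).  The axioms of a cochain complex are recorded separately in
`Cx.IsComplex`. -/
structure Cx (k : Type u) [CommRing k] where
  X : ℤ → Type u
  [grp : ∀ i, AddCommGroup (X i)]
  [mod : ∀ i, Module k (X i)]
  d : ∀ i j : ℤ, X i →ₗ[k] X j

attribute [instance] Cx.grp Cx.mod

variable {k : Type u} [CommRing k]

/-- `A` is a genuine cochain complex: the differential is supported in degree `+1`
and squares to zero. -/
def Cx.IsComplex (A : Cx k) : Prop :=
  (∀ i j : ℤ, i + 1 ≠ j → A.d i j = 0) ∧ ∀ i j l : ℤ, (A.d j l).comp (A.d i j) = 0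

/-- Graded morphisms between two graded objects: doubly indexed families of `k`-linear
maps `A.X i →ₗ[k] B.X j`.  A degree-`n` morphism is such a family supported on
`j = i + n`, see `Mor.HasDeg`. -/
abbrev Mor (A B : Cx k) := ∀ i j : ℤ, A.X i →ₗ[k] B.X j

/-- `f` is homogeneous of degree `n`, i.e. supported on `j = i + n`. -/
def Mor.HasDeg {A B : Cx k} (f : Mor A B) (n : ℤ) : Prop :=
  ∀ i j : ℤ, i + n ≠ j → f i j = 0

/-- The differential `df = d_B ∘ f - (-1)ⁿ f ∘ d_A` of a degree-`n` morphism `f`. -/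
def Mor.diff {A B : Cx k} (n : ℤ) (f : Mor A B) : Mor A B := fun i j =>
  (B.d (i + n) j).comp (f i (i + n)) -
    (n.negOnePow : ℤ) • ((f (i + 1) j).comp (A.d i (i + 1)))

/-- Composition `g ∘ f` (the morphism `f`, of degree `m`, is applied first). -/
def Mor.comp {A B C : Cx k} (g : Mor B C) (f : Mor A B) (m : ℤ) : Mor A C := fun i j =>
  (g (i + m) j).comp (f i (i + m))

/-- Transport along an equality of degrees. -/
def Cx.cast (A : Cx k) : ∀ {i j : ℤ}, i = j → (A.X i →ₗ[k] A.X j)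
  | _, _, rfl => LinearMap.id

/-- The identity (degree-`0`) morphism. -/
def idM (A : Cx k) : Mor A A := fun i j => if h : i = j then A.cast h else 0

/-- `f` is closed as a degree-`n` morphism: `df = 0`. -/
def IsClosed {A B : Cx k} (n : ℤ) (f : Mor A B) : Prop := Mor.diff n f = 0

/-- A chain map is a closed morphism of degree `0`. -/
def IsChainMap {A B : Cx k} (f : Mor A B) : Prop := Mor.HasDeg f 0 ∧ IsClosed 0 f

/-- Two degree-`n` morphisms are homotopic if their difference is the differential of a
morphism of degree `n - 1`. -/
def Homotopic {A B : Cx k} (n : ℤ) (f g : Mor A B) : Prop :=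
  ∃ s : Mor A B, Mor.HasDeg s (n - 1) ∧ Mor.diff (n - 1) s = f - g

/-- `g` is a homotopy inverse of the chain map `f`: both are chain maps and both
composites are homotopic to the identity. -/
def AreHtpyInverse {A B : Cx k} (f : Mor A B) (g : Mor B A) : Prop :=
  IsChainMap f ∧ IsChainMap g ∧
    Homotopic 0 (Mor.comp g f 0) (idM A) ∧ Homotopic 0 (Mor.comp f g 0) (idM B)

/-- A chain map is a homotopy equivalence if it admits a homotopy inverse. -/
def IsHtpyEquiv {A B : Cx k} (f : Mor A B) : Prop := ∃ g : Mor B A, AreHtpyInverse f g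

variable {M₁ M₂ N₁ N₂ P₁ P₂ : Cx k}

/-- A triple morphism `(μ¹, μ⁰, μ²)` from `(M₁, m, M₂)` to `(N₁, n, N₂)`. -/
structure Triple (M₁ M₂ N₁ N₂ : Cx k) where
  one : Mor M₁ N₁
  zero : Mor M₁ N₂
  two : Mor M₂ N₂

/-- A triple morphism has degree `κ` if `μ¹, μ²` have degree `κ` and `μ⁰` has degree
`κ - 1`. -/
def Triple.HasDeg (μ : Triple M₁ M₂ N₁ N₂) (κ : ℤ) : Prop :=
  Mor.HasDeg μ.one κ ∧ Mor.HasDeg μ.zero (κ - 1) ∧ Mor.HasDeg μ.two κ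

/-- The differential `Dμ = (dμ¹, dμ⁰ + (-1)^κ (n ∘ μ¹ - μ² ∘ m), dμ²)` of a degree-`κ`
triple morphism over the chain maps `m`, `n`. -/
def Triple.diffT (m : Mor M₁ M₂) (n : Mor N₁ N₂) (κ : ℤ) (μ : Triple M₁ M₂ N₁ N₂) :
    Triple M₁ M₂ N₁ N₂ where
  one := Mor.diff κ μ.one
  zero := Mor.diff (κ - 1) μ.zero +
    (κ.negOnePow : ℤ) • (Mor.comp n μ.one κ - Mor.comp μ.two m 0)
  two := Mor.diff κ μ.two

/-- `μ` is closed: `Dμ = 0`. -/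
def Triple.IsClosedT (m : Mor M₁ M₂) (n : Mor N₁ N₂) (κ : ℤ)
    (μ : Triple M₁ M₂ N₁ N₂) : Prop :=
  (Triple.diffT m n κ μ).one = 0 ∧ (Triple.diffT m n κ μ).zero = 0 ∧
    (Triple.diffT m n κ μ).two = 0

/-- Two degree-`κ` triple morphisms are homotopic if their difference is `Dξ` for a
degree-`κ - 1` triple morphism `ξ`. -/
def Triple.HomotopicT (m : Mor M₁ M₂) (n : Mor N₁ N₂) (κ : ℤ)
    (μ ν : Triple M₁ M₂ N₁ N₂) : Prop :=
  ∃ ξ : Triple M₁ M₂ N₁ N₂, ξ.HasDeg (κ - 1) ∧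
    (Triple.diffT m n (κ - 1) ξ).one = μ.one - ν.one ∧
    (Triple.diffT m n (κ - 1) ξ).zero = μ.zero - ν.zero ∧
    (Triple.diffT m n (κ - 1) ξ).two = μ.two - ν.two

/-- Composition of triple morphisms (the morphism `μ`, of degree `κ`, is applied first):
`ν ∘ μ = (ν¹ ∘ μ¹, ν² ∘ μ⁰ + (-1)^κ ν⁰ ∘ μ¹, ν² ∘ μ²)`. -/
def Triple.compT (ν : Triple N₁ N₂ P₁ P₂) (μ : Triple M₁ M₂ N₁ N₂) (κ : ℤ) :
    Triple M₁ M₂ P₁ P₂ where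
  one := Mor.comp ν.one μ.one κ
  zero := Mor.comp ν.two μ.zero (κ - 1) + (κ.negOnePow : ℤ) • Mor.comp ν.zero μ.one κ
  two := Mor.comp ν.two μ.two κ

/-- The identity triple morphism `(id, 0, id)`. -/
def Triple.idT (M₁ M₂ : Cx k) : Triple M₁ M₂ M₁ M₂ := ⟨idM M₁, 0, idM M₂⟩

/-- A closed degree-`0` triple morphism `μ` over `(m, n)` is a homotopy equivalence in
the triple category if there is a closed degree-`0` triple `ν` in the opposite
direction with `ν ∘ μ - id` and `μ ∘ ν - id` both of the form `Dξ` for degree-`-1`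
triples `ξ`. -/
def Triple.IsHtpyEquivT (m : Mor M₁ M₂) (n : Mor N₁ N₂) (μ : Triple M₁ M₂ N₁ N₂) : Prop :=
  μ.HasDeg 0 ∧ Triple.IsClosedT m n 0 μ ∧
    ∃ ν : Triple N₁ N₂ M₁ M₂, ν.HasDeg 0 ∧ Triple.IsClosedT n m 0 ν ∧
      Triple.HomotopicT m m 0 (ν.compT μ 0) (Triple.idT M₁ M₂) ∧
      Triple.HomotopicT n n 0 (μ.compT ν 0) (Triple.idT N₁ N₂)

section Calculus

variable {A B C E : Cx k}

lemma Mor.HasDeg.add {f g : Mor A B} {n : ℤ} (hf : f.HasDeg n) (hg : g.HasDeg n) :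
    Mor.HasDeg (f + g) n := fun i j h => by
  simp [hf i j h, hg i j h]

lemma Mor.HasDeg.neg {f : Mor A B} {n : ℤ} (hf : f.HasDeg n) : Mor.HasDeg (-f) n :=
  fun i j h => by simp [hf i j h]

lemma Mor.HasDeg.sub {f g : Mor A B} {n : ℤ} (hf : f.HasDeg n) (hg : g.HasDeg n) :
    Mor.HasDeg (f - g) n := fun i j h => by
  simp [hf i j h, hg i j h]

lemma Mor.HasDeg.comp {g : Mor B C} {m n : ℤ} (hg : g.HasDeg (n - m)) (f : Mor A B) :
    Mor.HasDeg (Mor.comp g f m) n := fun i j h => by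
  simp [Mor.comp, hg (i + m) j (by omega)]

lemma Mor.comp_add (g : Mor B C) (f f' : Mor A B) (m : ℤ) :
    Mor.comp g (f + f') m = Mor.comp g f m + Mor.comp g f' m := by
  funext i j; simp [Mor.comp, LinearMap.comp_add]

lemma Mor.comp_sub (g : Mor B C) (f f' : Mor A B) (m : ℤ) :
    Mor.comp g (f - f') m = Mor.comp g f m - Mor.comp g f' m := by
  funext i j; simp [Mor.comp, LinearMap.comp_sub]

lemma Mor.comp_zero (g : Mor B C) (m : ℤ) : Mor.comp g (0 : Mor A B) m = 0 := by
  funext i j; simp [Mor.comp]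

lemma Mor.add_comp (g g' : Mor B C) (f : Mor A B) (m : ℤ) :
    Mor.comp (g + g') f m = Mor.comp g f m + Mor.comp g' f m := by
  funext i j; simp [Mor.comp, LinearMap.add_comp]

lemma Mor.sub_comp (g g' : Mor B C) (f : Mor A B) (m : ℤ) :
    Mor.comp (g - g') f m = Mor.comp g f m - Mor.comp g' f m := by
  funext i j; simp [Mor.comp, LinearMap.sub_comp]

lemma Mor.zero_comp (f : Mor A B) (m : ℤ) : Mor.comp (0 : Mor B C) f m = 0 := by
  funext i j; simp [Mor.comp]

lemma Mor.comp_assoc (h : Mor C E) (g : Mor B C) (f : Mor A B) (m l : ℤ) :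
    Mor.comp (Mor.comp h g m) f l = Mor.comp h (Mor.comp g f l) (l + m) := by
  funext i j
  simp only [Mor.comp, LinearMap.comp_assoc]
  rw [add_assoc i l m]

lemma Mor.comp_idM (f : Mor A B) : Mor.comp f (idM A) 0 = f := by
  funext i j
  have key : ∀ i' (h : i = i'), (f i' j).comp (idM A i i') = f i j := by
    rintro _ rfl
    simp [idM, Cx.cast]
  exact key _ (add_zero i).symm

lemma Mor.idM_comp {f : Mor A B} {m : ℤ} (hf : f.HasDeg m) : Mor.comp (idM B) f m = f := by
  funext i j
  by_cases h : i + m = j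
  · subst h
    simp [Mor.comp, idM, Cx.cast]
  · simp [Mor.comp, idM, h, hf i j h]

lemma Mor.diff_add (n : ℤ) (f g : Mor A B) :
    Mor.diff n (f + g) = Mor.diff n f + Mor.diff n g := by
  funext i j
  simp only [Mor.diff, Pi.add_apply, LinearMap.comp_add, LinearMap.add_comp, smul_add]
  abel

lemma Mor.diff_neg (n : ℤ) (f : Mor A B) : Mor.diff n (-f) = -Mor.diff n f := by
  funext i j
  simp only [Mor.diff, Pi.neg_apply, LinearMap.comp_neg, LinearMap.neg_comp, smul_neg]
  abel

lemma Mor.diff_sub (n : ℤ) (f g : Mor A B) :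
    Mor.diff n (f - g) = Mor.diff n f - Mor.diff n g := by
  rw [sub_eq_add_neg, Mor.diff_add, Mor.diff_neg, ← sub_eq_add_neg]

/-- The graded Leibniz rule. -/
lemma Mor.diff_comp (n m : ℤ) (g : Mor B C) (f : Mor A B) :
    Mor.diff n (Mor.comp g f m) =
      Mor.comp (Mor.diff (n - m) g) f m +
        ((n - m).negOnePow : ℤ) • Mor.comp g (Mor.diff m f) (m + 1) := by
  obtain ⟨l, rfl⟩ : ∃ l, n = l + m := ⟨n - m, by ring⟩
  funext i j
  have e₁ : i + (l + m) = i + m + l := by ring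
  have e₂ : i + (m + 1) = i + m + 1 := by ring
  have e₃ : i + 1 + m = i + m + 1 := by ring
  simp only [Mor.diff, Mor.comp, Pi.add_apply, Pi.smul_apply, add_sub_cancel_right,
    LinearMap.sub_comp, LinearMap.comp_sub, LinearMap.smul_comp, LinearMap.comp_smul,
    LinearMap.comp_assoc, smul_sub, smul_smul, Int.negOnePow_add, Units.val_mul]
  rw [e₁, e₂, e₃]
  abel

end Calculus

section HomotopyEquivalences

/-- The homotopies witnessing a homotopy equivalence can be chosen to be compatible with each
other up to a homotopy of degree `-2`. -/
lemma IsHtpyEquiv.exists_coherent {A B : Cx k} {f : Mor A B} (hf : IsHtpyEquiv f) :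
    ∃ (f' : Mor B A) (h : Mor A A) (h' : Mor B B) (p : Mor A B),
      f'.HasDeg 0 ∧ h.HasDeg (-1) ∧ h'.HasDeg (-1) ∧ p.HasDeg (-2) ∧
      Mor.diff 0 f' = 0 ∧
      Mor.diff (-1) h = Mor.comp f' f 0 - idM A ∧
      Mor.diff (-1) h' = Mor.comp f f' 0 - idM B ∧
      Mor.diff (-2) p = Mor.comp f h (-1) - Mor.comp h' f 0 := by
  obtain ⟨f', ⟨hfd, hfc⟩, ⟨hfd', hfc'⟩, ⟨h, hd, hh⟩, ⟨h', hd', hh'⟩⟩ := hf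
  simp only [zero_sub, IsClosed] at hfc hfc' hd hh hd' hh'
  refine ⟨f', h, h' + Mor.comp (Mor.comp f h (-1) - Mor.comp h' f 0) f' 0,
    Mor.comp (Mor.comp f h (-1) - Mor.comp h' f 0) h (-1), hfd', hd, ?_, ?_, hfc', hh, ?_, ?_⟩
  · exact hd'.add (.comp (.sub (.comp hfd _) (.comp hd' _)) _)
  · exact .comp (.sub (.comp hfd _) (.comp hd' _)) _
  · simp [Mor.diff_add, Mor.diff_sub, Mor.diff_comp, Mor.comp_assoc, Mor.comp_sub,
      Mor.sub_comp, Mor.idM_comp, Mor.HasDeg.comp, Mor.zero_comp, Mor.comp_zero, *]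
  · simp [Mor.diff_sub, Mor.diff_comp, Mor.comp_assoc, Mor.comp_sub, Mor.sub_comp,
      Mor.add_comp, Mor.comp_idM, Mor.idM_comp, Mor.HasDeg.comp, Mor.zero_comp, *]
    abel

variable {m : Mor M₁ M₂} {n : Mor N₁ N₂} {μ : Triple M₁ M₂ N₁ N₂}

lemma Triple.IsHtpyEquivT.one (h : Triple.IsHtpyEquivT m n μ) : IsHtpyEquiv μ.one := by
  obtain ⟨hd, hc, ν, hνd, hνc, ⟨ξ, hξ, h₁, -, -⟩, ⟨η, hη, h₂, -, -⟩⟩ := h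
  exact ⟨ν.one, ⟨hd.1, hc.1⟩, ⟨hνd.1, hνc.1⟩, ⟨ξ.one, hξ.1, h₁⟩, ⟨η.one, hη.1, h₂⟩⟩

lemma Triple.IsHtpyEquivT.two (h : Triple.IsHtpyEquivT m n μ) : IsHtpyEquiv μ.two := by
  obtain ⟨hd, hc, ν, hνd, hνc, ⟨ξ, hξ, -, -, h₁⟩, ⟨η, hη, -, -, h₂⟩⟩ := h
  exact ⟨ν.two, ⟨hd.2.2, hc.2.2⟩, ⟨hνd.2.2, hνc.2.2⟩, ⟨ξ.two, hξ.2.2, h₁⟩, ⟨η.two, hη.2.2, h₂⟩⟩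

lemma Triple.IsClosedT.diff_zero (hμ : Triple.IsClosedT m n 0 μ) :
    Mor.diff (-1) μ.zero = Mor.comp μ.two m 0 - Mor.comp n μ.one 0 := by
  have h := hμ.2.1
  simp only [Triple.diffT, zero_sub, Int.negOnePow_zero, Units.val_one, one_smul] at h
  rw [eq_neg_of_add_eq_zero_left h, neg_sub]

/-- The homotopy `-μ⁰` witnesses commutativity up to homotopy of the square underlying a closed
triple morphism. -/
lemma Triple.IsClosedT.homotopic (hμd : μ.HasDeg 0) (hμ : Triple.IsClosedT m n 0 μ) :
    Homotopic 0 (Mor.comp n μ.one 0) (Mor.comp μ.two m 0) :=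
  ⟨-μ.zero, hμd.2.1.neg, by rw [Mor.diff_neg, zero_sub, hμ.diff_zero, neg_sub]⟩

/-- A closed triple morphism whose outer components are homotopy equivalences is a homotopy
equivalence. -/
lemma Triple.isHtpyEquivT_of_isHtpyEquiv (hm : IsChainMap m) (hn : IsChainMap n)
    (hμd : μ.HasDeg 0) (hμc : Triple.IsClosedT m n 0 μ)
    (h₁ : IsHtpyEquiv μ.one) (h₂ : IsHtpyEquiv μ.two) : Triple.IsHtpyEquivT m n μ := by
  refine ⟨hμd, hμc, ?_⟩
  have ha := hμc.diff_zero
  obtain ⟨hfc, -, hgc⟩ := hμc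
  obtain ⟨hfd, had, hgd⟩ := hμd
  obtain ⟨f, a, g⟩ := μ
  obtain ⟨hmd, hmc⟩ := hm
  obtain ⟨hnd, hnc⟩ := hn
  obtain ⟨f', h, h', p, hfd', hhd, hhd', hpd, hfc', hh, hh', hp⟩ := h₁.exists_coherent
  obtain ⟨g', l, l', q, hgd', hld, hld', hqd, hgc', hl, hl', hq⟩ := h₂.exists_coherent
  simp only [Triple.diffT, IsClosed, zero_sub] at *
  refine ⟨⟨f', Mor.comp l (Mor.comp m f' 0) 0 - Mor.comp g' (Mor.comp a f' 0) (-1) -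
      Mor.comp g' (Mor.comp n h' (-1)) (-1), g'⟩, ⟨hfd', ?_, hgd'⟩, ⟨hfc', ?_, hgc'⟩,
    ⟨⟨h, Mor.comp g' (Mor.comp n p (-2)) (-2) + Mor.comp g' (Mor.comp a h (-1)) (-2) -
      Mor.comp l (Mor.comp m h (-1)) (-1), l⟩, ⟨hhd, ?_, hld⟩, hh, ?_, hl⟩,
    ⟨⟨h', Mor.comp q (Mor.comp m f' 0) 0 - Mor.comp l' (Mor.comp a f' 0) (-1) -
      Mor.comp l' (Mor.comp n h' (-1)) (-1), l'⟩, ⟨hhd', ?_, hld'⟩, hh', ?_, hl'⟩⟩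
  · exact .sub (.sub (.comp hld _) (.comp hgd' _)) (.comp hgd' _)
  · simp only [Triple.diffT]
    simp [Mor.diff_sub, Mor.diff_comp, Mor.comp_assoc, Mor.comp_sub, Mor.sub_comp,
      Mor.comp_idM, Mor.idM_comp, Mor.HasDeg.comp, Mor.zero_comp, Mor.comp_zero, *]
  · exact .sub (.add (.comp hgd' _) (.comp hgd' _)) (.comp hld _)
  · simp only [Triple.diffT, Triple.compT, Triple.idT]
    simp [Mor.diff_sub, Mor.diff_add, Mor.diff_comp, Mor.comp_assoc, Mor.comp_sub,
      Mor.sub_comp, Mor.comp_add, Mor.comp_idM, Mor.idM_comp, Mor.HasDeg.comp, Mor.zero_comp, *]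
    abel
  · exact .sub (.sub (.comp hqd _) (.comp hld' _)) (.comp hld' _)
  · simp only [Triple.diffT, Triple.compT, Triple.idT]
    simp [Mor.diff_sub, Mor.diff_comp, Mor.comp_assoc, Mor.comp_sub, Mor.sub_comp,
      Mor.comp_idM, Mor.idM_comp, Mor.HasDeg.comp, Mor.zero_comp, Mor.comp_zero, *]
    abel

end HomotopyEquivalences

/-- **Equivalence Lemma.** A closed degree-`0` triple morphism `μ` over homotopy
equivalences `m`, `n` is a homotopy equivalence in the triple category iff `μ¹` and
`μ²` are homotopy equivalences and `n ∘ μ¹` is homotopic to `μ² ∘ m`. -/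
theorem statement_0 {M₁ M₂ N₁ N₂ : Cx k}
    (hM₁ : M₁.IsComplex) (hM₂ : M₂.IsComplex) (hN₁ : N₁.IsComplex) (hN₂ : N₂.IsComplex)
    (m : Mor M₁ M₂) (n : Mor N₁ N₂) (hm : IsChainMap m) (hn : IsChainMap n)
    (hme : IsHtpyEquiv m) (hne : IsHtpyEquiv n)
    (μ : Triple M₁ M₂ N₁ N₂) (hμd : μ.HasDeg 0) (hμc : Triple.IsClosedT m n 0 μ) :
    Triple.IsHtpyEquivT m n μ ↔
      IsHtpyEquiv μ.one ∧ IsHtpyEquiv μ.two ∧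
        Homotopic 0 (Mor.comp n μ.one 0) (Mor.comp μ.two m 0) := by
  refine ⟨fun h => ⟨h.one, h.two, hμc.homotopic hμd⟩, fun h => ?_⟩
  exact Triple.isHtpyEquivT_of_isHtpyEquiv hm hn hμd hμc h.1 h.2.1

end ThesisDG
end

section
/- Let A and B be cochain complexes of k-modules, let f : A → B be a chain map, and let g : B → A be a degree-0 morphism (a family of k-linear maps g^i : B^i → A^i, not assumed to commute with the differentials) such that g ∘ f = id and f ∘ g is homotopic to id (i.e., there is a degree −1 morphism h : B → B with d ∘ h + h ∘ d = f ∘ g − id). Then g is a chain map (it commutes with the differentials, dg = 0), and consequently f is a homotopy equivalence with homotopy inverse g. -/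
namespace ThesisDG

universe u

variable {k : Type u} [CommRing k]

theorem Mor.diff_apply {A B : Cx k} (n : ℤ) (f : Mor A B) {i m l : ℤ} (j : ℤ)
    (hm : i + n = m) (hl : i + 1 = l) (x : A.X i) :
    Mor.diff n f i j x =
      B.d m j (f i m x) - (n.negOnePow : ℤ) • f l j (A.d i l x) := by
  subst hm hl
  rfl

theorem Mor.comp_zero_apply {A B C : Cx k} (g : Mor B C) (f : Mor A B) (i j : ℤ)
    (x : A.X i) : Mor.comp g f 0 i j x = g i j (f i i x) := by
  have h : ∀ m : ℤ, m = i → g m j (f i m x) = g i j (f i i x) := by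
    rintro m rfl
    rfl
  exact h _ (add_zero i)

theorem idM_apply_self (A : Cx k) (i : ℤ) (x : A.X i) : idM A i i x = x := by
  simp only [idM, dite_true]
  rfl

theorem Homotopic.refl {A B : Cx k} (n : ℤ) (f : Mor A B) : Homotopic n f f := by
  refine ⟨0, fun _ _ _ => rfl, ?_⟩
  funext i j
  ext x
  simp [Mor.diff]

/-- A closed degree-`0` morphism commutes with the differentials. -/
theorem IsClosed.comm {A B : Cx k} {f : Mor A B} (hf : IsClosed 0 f) {i j : ℤ}
    (hij : i + 1 = j) (x : A.X i) : B.d i j (f i i x) = f j j (A.d i j x) := by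
  have h := Mor.diff_apply 0 f j (add_zero i) hij x
  rw [show Mor.diff 0 f = 0 from hf] at h
  exact sub_eq_zero.mp (by simpa using h.symm)

/-- A degree-`0` morphism commuting with the differentials is closed. -/
theorem IsClosed.of_comm {A B : Cx k} (hB : B.IsComplex) {f : Mor A B}
    (hf : Mor.HasDeg f 0)
    (h : ∀ i j : ℤ, i + 1 = j → ∀ x : A.X i, B.d i j (f i i x) = f j j (A.d i j x)) :
    IsClosed 0 f := by
  funext i j
  ext x
  rw [Mor.diff_apply 0 f j (add_zero i) rfl x]
  by_cases hij : i + 1 = j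
  · subst hij
    simp [h i _ rfl x]
  · simp [hB.1 i j hij, hf (i + 1) j (by simpa using hij)]

/-- A degree-`0` endomorphism homotopic to the identity commutes with the differential. -/
theorem Homotopic.comm_of_idM {B : Cx k} (hB : B.IsComplex) {p : Mor B B}
    (hp : Homotopic 0 p (idM B)) {i j : ℤ} (hij : i + 1 = j) (x : B.X i) :
    B.d i j (p i i x) = p j j (B.d i j x) := by
  obtain ⟨s, -, hs⟩ := hp
  have key : ∀ a b c : ℤ, a + 1 = b → b + 1 = c → ∀ y : B.X b,
      p b b y = B.d a b (s b a y) + s c b (B.d b c y) + y := by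
    intro a b c hab hbc y
    have h := Mor.diff_apply (0 - 1) s (i := b) (m := a) b (by omega) hbc y
    rw [hs] at h
    simp only [Pi.sub_apply, LinearMap.sub_apply, idM_apply_self] at h
    rw [sub_eq_iff_eq_add] at h
    simpa using h
  have hdd : ∀ (a b c : ℤ) (y : B.X a), B.d b c (B.d a b y) = 0 := fun a b c y =>
    LinearMap.congr_fun (hB.2 a b c) y
  rw [key (i - 1) i j (by omega) hij x, key i j (j + 1) hij rfl]
  simp [hdd]

/-- If `f` is a chain map, `g` a degree-`0` morphism with `g ∘ f = id` and
`f ∘ g ∼ id`, then `g` is automatically a chain map, and `f` is a homotopy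
equivalence with homotopy inverse `g`. -/
theorem statement_3 {A B : Cx k} (hA : A.IsComplex) (hB : B.IsComplex)
    (f : Mor A B) (hf : IsChainMap f)
    (g : Mor B A) (hg : Mor.HasDeg g 0)
    (hgf : Mor.comp g f 0 = idM A)
    (hfg : Homotopic 0 (Mor.comp f g 0) (idM B)) :
    IsClosed 0 g ∧ AreHtpyInverse f g := by
  have hgf' : ∀ (i : ℤ) (x : A.X i), g i i (f i i x) = x := fun i x => by
    rw [← Mor.comp_zero_apply, hgf, idM_apply_self]
  have hg' : IsClosed 0 g := by
    refine IsClosed.of_comm hA hg fun i j hij x => ?_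
    have h := hfg.comm_of_idM hB hij x
    rw [Mor.comp_zero_apply, Mor.comp_zero_apply, hf.2.comm hij] at h
    rw [← hgf' j (A.d i j (g i i x)), h, hgf']
  exact ⟨hg', hf, ⟨hg, hg'⟩, hgf ▸ Homotopic.refl 0 _, hfg⟩

end ThesisDG
end

section
/- Let X be a topological space and let {Sᵢ}_{i ∈ I} be a family of pairwise disjoint nonempty subsets covering X such that (i) the family is locally finite: every point of X has a neighbourhood meeting only finitely many Sᵢ, and (ii) the condition of the frontier holds: for every i, the frontier closure(Sᵢ) ∖ Sᵢ is a union of members of the family (i.e., for all j, if Sⱼ meets closure(Sᵢ) ∖ Sᵢ then Sⱼ ⊆ closure(Sᵢ) ∖ Sᵢ). Then for every i the star of Sᵢ, defined as star(Sᵢ) := ⋃ { Sⱼ : Sᵢ ⊆ closure(Sⱼ) }, is an open subset of X. -/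
/-- Under the condition of the frontier, a stratum meeting the closure of another one is contained
in that closure. -/
theorem subset_closure_of_mem_of_frontier {X : Type*} [TopologicalSpace X] {ι : Type*}
    {S : ι → Set X} (hdisj : ∀ i j : ι, i ≠ j → Disjoint (S i) (S j))
    (hfrontier : ∀ i j : ι, (S j ∩ (closure (S i) \ S i)).Nonempty →
      S j ⊆ closure (S i) \ S i)
    {j k : ι} {x : X} (hj : x ∈ S j) (hk : x ∈ closure (S k)) : S j ⊆ closure (S k) := by
  obtain rfl | hjk := eq_or_ne j k
  · exact subset_closure
  · exact (hfrontier k j ⟨x, hj, hk, Set.disjoint_left.mp (hdisj j k hjk) hj⟩).trans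
      Set.sdiff_subset

/-- For a stratification (a pairwise disjoint, locally finite cover by nonempty pieces
satisfying the condition of the frontier) of a topological space, the star of every
stratum—the union of all strata whose closure contains it—is open. -/
theorem statement_13 {X : Type*} [TopologicalSpace X] {ι : Type*} (S : ι → Set X)
    (hne : ∀ i, (S i).Nonempty)
    (hdisj : ∀ i j : ι, i ≠ j → Disjoint (S i) (S j))
    (hcover : ⋃ i, S i = Set.univ)
    (hlf : LocallyFinite S)
    (hfrontier : ∀ i j : ι, (S j ∩ (closure (S i) \ S i)).Nonempty →
      S j ⊆ closure (S i) \ S i)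
    (i : ι) :
    IsOpen (⋃ j ∈ {j : ι | S i ⊆ closure (S j)}, S j) := by
  have hclosed : IsClosed (⋃ k : {k : ι // ¬ S i ⊆ closure (S k)}, closure (S k)) :=
    (hlf.closure.comp_injective Subtype.val_injective).isClosed_iUnion fun _ ↦ isClosed_closure
  convert hclosed.isOpen_compl using 1
  ext x
  simp only [Set.mem_iUnion, Set.mem_ofPred_eq, Set.mem_compl_iff, exists_prop]
  constructor
  · rintro ⟨j, hij, hxj⟩ ⟨⟨k, hik⟩, hxk⟩
    exact hik (hij.trans (closure_minimal
      (subset_closure_of_mem_of_frontier hdisj hfrontier hxj hxk) isClosed_closure))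
  · intro hx
    obtain ⟨j, hxj⟩ := Set.mem_iUnion.mp (hcover ▸ Set.mem_univ x)
    exact ⟨j, by_contra fun hij ↦ hx ⟨⟨j, hij⟩, subset_closure hxj⟩, hxj⟩
end

section
/- Let k be a field of characteristic zero, A a ℤ/2-graded associative unital k-algebra, and d : A → A a k-linear map of odd degree satisfying the graded Leibniz rule d(xy) = (dx)y + (−1)^r x(dy) for x homogeneous of degree r. Fix an integer p ≥ 3 and elements aᵢ ∈ A odd for 1 ≤ i ≤ p, b_{ij} ∈ A even for p ≥ i > j ≥ 1, c_{ij} ∈ A odd for p ≥ i > j ≥ 1, with the conventions b_{ii} := 1, c_{ii} := 1 for all i ≥ 0, and c_{i0} := aᵢ for i ≥ 1. Assume d c_{ij} = −δ_{i−j,p}·1 + Σ_{k=j+1}^{i−1} c_{ik} c_{kj} for all p ≥ i > j ≥ 0 (which for j = 0 encodes d aᵢ = −δ_{i,p}·1 + Σ_{k=1}^{i−1} c_{ik} a_k), and d b_{ij} = Σ_{k=j}^{i} ( c_{ik} b_{kj} − b_{ik} c_{(k−1)(j−1)} ) for all p ≥ i > j ≥ 1. Define β_{ii} := 1 for i ≥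 0, β_{i0} := 0 for i > 0, and recursively β_{ij} := Σ_{k=j}^{i} b_{ik} β_{(k−1)(j−1)} for i > j ≥ 1; and define ā_i := aᵢ − Σ_{j=1}^{i−1} β_{ij} ā_j for 1 ≤ i ≤ p. Then for all p ≥ i ≥ j ≥ 0: d β_{ij} = Σ_{k=j+1}^{i} ( c_{i(k−1)} β_{(k−1)j} − β_{ik} ā_{k−j} ). -/
open Finset in
/-- Exchange of summation over the triangle `j ≤ l ≤ m ≤ i`. -/
theorem sum_Icc_Icc_comm_triangle {M : Type*} [AddCommMonoid M] (i j : ℕ) (f : ℕ → ℕ → M) :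
    ∑ l ∈ Icc j i, ∑ m ∈ Icc l i, f l m = ∑ m ∈ Icc j i, ∑ l ∈ Icc j m, f l m := by
  refine Finset.sum_comm' fun x y => ?_
  simp only [mem_Icc]
  omega

open Finset in
/-- The key identity `dβ_{ij} = Σ_{k=j+1}^{i} (c_{i(k-1)} β_{(k-1)j} - β_{ik} ā_{k-j})`
from the simplification of the Chekanov–Eliashberg dga `CE*(Λ_{p,1})`. -/
theorem statement_16 {k : Type*} [Field k] [CharZero k]
    {A : Type*} [Ring A] [Algebra k A]
    (A₀ A₁ : Submodule k A)
    (hsup : A₀ ⊔ A₁ = ⊤) (hinf : A₀ ⊓ A₁ = ⊥)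
    (hone : (1 : A) ∈ A₀)
    (h00 : ∀ x ∈ A₀, ∀ y ∈ A₀, x * y ∈ A₀)
    (h01 : ∀ x ∈ A₀, ∀ y ∈ A₁, x * y ∈ A₁)
    (h10 : ∀ x ∈ A₁, ∀ y ∈ A₀, x * y ∈ A₁)
    (h11 : ∀ x ∈ A₁, ∀ y ∈ A₁, x * y ∈ A₀)
    (d : A →ₗ[k] A)
    (hd01 : ∀ x ∈ A₀, d x ∈ A₁) (hd10 : ∀ x ∈ A₁, d x ∈ A₀)
    (hLeib₀ : ∀ x ∈ A₀, ∀ y : A, d (x * y) = d x * y + x * d y)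
    (hLeib₁ : ∀ x ∈ A₁, ∀ y : A, d (x * y) = d x * y - x * d y)
    (p : ℕ) (hp : 3 ≤ p)
    (a : ℕ → A) (b c : ℕ → ℕ → A)
    (haodd : ∀ i, 1 ≤ i → i ≤ p → a i ∈ A₁)
    (hbeven : ∀ i j, 1 ≤ j → j < i → i ≤ p → b i j ∈ A₀)
    (hcodd : ∀ i j, j < i → i ≤ p → c i j ∈ A₁)
    (hbii : ∀ i, b i i = 1) (hcii : ∀ i, c i i = 1)
    (hci0 : ∀ i, 1 ≤ i → c i 0 = a i)
    (hdc : ∀ i j, j < i → i ≤ p →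
      d (c i j) = -(if i - j = p then (1 : A) else 0) + ∑ l ∈ Ioo j i, c i l * c l j)
    (hdb : ∀ i j, 1 ≤ j → j < i → i ≤ p →
      d (b i j) = ∑ l ∈ Icc j i, (c i l * b l j - b i l * c (l - 1) (j - 1)))
    (β : ℕ → ℕ → A)
    (hβii : ∀ i, β i i = 1)
    (hβi0 : ∀ i, 1 ≤ i → β i 0 = 0)
    (hβrec : ∀ i j, 1 ≤ j → j < i → β i j = ∑ l ∈ Icc j i, b i l * β (l - 1) (j - 1))
    (abar : ℕ → A)
    (habar : ∀ i, 1 ≤ i → i ≤ p → abar i = a i - ∑ j ∈ Ico 1 i, β i j * abar j)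
    :
    ∀ i j, j ≤ i → i ≤ p →
      d (β i j) =
        ∑ l ∈ Icc (j + 1) i, (c i (l - 1) * β (l - 1) j - β i l * abar (l - j)) := by
  have hd1 : d 1 = 0 := by simpa using hLeib₀ 1 hone 1
  have hrec : ∀ i n, n + 1 ≤ i →
      β i (n + 1) = ∑ l ∈ Icc (n + 1) i, b i l * β (l - 1) n := by
    intro i n h
    rcases h.eq_or_lt with rfl | h
    · simp [hβii, hbii]
    · simpa using hβrec i (n + 1) (by omega) h
  have hdb' : ∀ i j, 1 ≤ j → j ≤ i → i ≤ p →
      d (b i j) = ∑ l ∈ Icc j i, (c i l * b l j - b i l * c (l - 1) (j - 1)) := by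
    intro i j h1 h hi
    rcases h.eq_or_lt with rfl | h
    · simp [hbii, hcii, hd1]
    · exact hdb i j h1 h hi
  have hb0 : ∀ i j, 1 ≤ j → j ≤ i → i ≤ p → b i j ∈ A₀ := by
    intro i j h1 h hi
    rcases h.eq_or_lt with rfl | h
    · rw [hbii]; exact hone
    · exact hbeven i j h1 h hi
  intro i j
  induction j generalizing i with
  | zero =>
    intro _ hi
    rcases Nat.eq_zero_or_pos i with rfl | hpos
    · simp [hβii, hd1]
    · have hfirst : ∑ l ∈ Icc 1 i, c i (l - 1) * β (l - 1) 0 = a i := by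
        rw [sum_eq_single_of_mem 1 (by simp; omega)]
        · simp [hβii, hci0 i hpos]
        · intro l hl hne
          rw [mem_Icc] at hl
          rw [hβi0 _ (by omega), mul_zero]
      have hsecond : ∑ l ∈ Icc 1 i, β i l * abar l = a i := by
        rw [← Ico_insert_right hpos, sum_insert (by simp), hβii, one_mul, habar i hpos hi]
        abel
      simp [hβi0 i hpos, sum_sub_distrib, hfirst, hsecond]
  | succ n ih =>
    intro hj hi
    have hleib : d (β i (n + 1)) = ∑ l ∈ Icc (n + 1) i,
        ((∑ m ∈ Icc l i, (c i m * b m l - b i m * c (m - 1) (l - 1))) * β (l - 1) n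
          + b i l * ∑ m ∈ Icc (n + 1) (l - 1),
            (c (l - 1) (m - 1) * β (m - 1) n - β (l - 1) m * abar (m - n))) := by
      rw [hrec i n hj, map_sum]
      refine sum_congr rfl fun l hl => ?_
      rw [mem_Icc] at hl
      rw [hLeib₀ _ (hb0 i l (by omega) hl.2 hi), hdb' i l (by omega) hl.2 hi,
        ih (l - 1) (by omega) (by omega)]
    have hcb : ∑ l ∈ Icc (n + 1) i, ∑ m ∈ Icc l i, c i m * b m l * β (l - 1) n
        = ∑ l ∈ Icc (n + 1 + 1) i, c i (l - 1) * β (l - 1) (n + 1) + β i (n + 1) := by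
      rw [sum_Icc_Icc_comm_triangle]
      have hinner : ∀ m ∈ Icc (n + 1) i,
          ∑ l ∈ Icc (n + 1) m, c i m * b m l * β (l - 1) n = c i m * β m (n + 1) := by
        intro m hm
        rw [mem_Icc] at hm
        simp only [hrec m n hm.1, mul_sum, mul_assoc]
      rw [sum_congr rfl hinner, ← Ico_insert_right hj, sum_insert (by simp), hcii, one_mul,
        add_comm]
      congr 1
      refine sum_bij' (fun m _ => m + 1) (fun l _ => l - 1) ?_ ?_ ?_ ?_ ?_ <;>
        simp only [mem_Icc, mem_Ico] <;> intros <;> first | omega | simp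
    have hbc : ∑ l ∈ Icc (n + 1) i, ∑ m ∈ Icc l i, b i m * c (m - 1) (l - 1) * β (l - 1) n
        = ∑ l ∈ Icc (n + 1) i, ∑ m ∈ Icc (n + 1) (l - 1),
            b i l * (c (l - 1) (m - 1) * β (m - 1) n) + β i (n + 1) := by
      rw [sum_Icc_Icc_comm_triangle, hrec i n hj, ← sum_add_distrib]
      refine sum_congr rfl fun l hl => ?_
      rw [mem_Icc] at hl
      obtain ⟨l, rfl⟩ : ∃ l', l = l' + 1 := ⟨l - 1, by omega⟩
      rw [sum_Icc_succ_top hl.1]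
      simp [hcii, mul_assoc]
    have hbβ : ∑ l ∈ Icc (n + 1) i, ∑ m ∈ Icc (n + 1) (l - 1),
          b i l * (β (l - 1) m * abar (m - n))
        = ∑ l ∈ Icc (n + 1 + 1) i, β i l * abar (l - (n + 1)) := by
      have hinner : ∀ l ∈ Icc (n + 1 + 1) i, β i l * abar (l - (n + 1))
          = ∑ m ∈ Icc l i, b i m * (β (m - 1) (l - 1) * abar (l - 1 - n)) := by
        intro l hl
        rw [mem_Icc] at hl
        obtain ⟨l, rfl⟩ : ∃ l', l = l' + 1 := ⟨l - 1, by omega⟩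
        simp only [hrec i l hl.2, sum_mul, mul_assoc, Nat.add_sub_cancel, Nat.add_sub_add_right]
      rw [sum_congr rfl hinner, sum_sigma', sum_sigma']
      refine sum_bij' (fun x _ => ⟨x.2 + 1, x.1⟩) (fun x _ => ⟨x.2, x.1 - 1⟩) ?_ ?_ ?_ ?_ ?_
      · simp only [mem_sigma, mem_Icc]; omega
      · simp only [mem_sigma, mem_Icc]; omega
      · simp
      · rintro ⟨x, y⟩ h
        simp only [mem_sigma, mem_Icc] at h
        simp only [Sigma.mk.injEq, heq_eq_eq, and_true]
        omega
      · simp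
    rw [hleib]
    simp only [sum_add_distrib, sum_sub_distrib, sum_mul, sub_mul, mul_sub, mul_sum]
    rw [hcb, hbc, hbβ]
    abel
end

section
/- Let k be a field of characteristic zero, A a ℤ/2-graded associative unital k-algebra, and d : A → A a k-linear map of odd degree satisfying the graded Leibniz rule d(xy) = (dx)y + (−1)^r x(dy) for x homogeneous of degree r. Fix an integer p ≥ 3 and elements aᵢ ∈ A odd for 1 ≤ i ≤ p, b_{ij} ∈ A even for p ≥ i > j ≥ 1, c_{ij} ∈ A odd for p ≥ i > j ≥ 1, with the conventions b_{ii} := 1, c_{ii} := 1 for all i ≥ 0, and c_{i0} := aᵢ for i ≥ 1. Assume d c_{ij} = −δ_{i−j,p}·1 + Σ_{k=j+1}^{i−1} c_{ik} c_{kj} for all p ≥ i > j ≥ 0, and d b_{ij} = Σ_{k=j}^{i} ( c_{ik} b_{kj} − b_{ik} c_{(k−1)(j−1)} ) for all p ≥ i > j ≥ 1. Define β_{ii} := 1 for i ≥ 0, β_{i0} := 0 for i > 0, β_{ij} := Σ_{k=j}^{i} b_{ik} β_{(k−1)(j−1)} for i > j ≥ 1, and ā_i := aᵢ − Σ_{j=1}^{i−1}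 β_{ij} ā_j for 1 ≤ i ≤ p. Then for all 1 ≤ i ≤ p: d ā_i = −δ_{i,p}·1 + Σ_{j=1}^{i−1} ā_{i−j} ā_j. -/
open Finset in
/-- A sum over `Icc (j + 1) (i + 1)`, reindexed as a sum over `range p` of truncated terms. -/
lemma sum_Icc_succ_eq_sum_range_ite {M : Type*} [AddCommMonoid M] {i p : ℕ} (hi : i < p) (j : ℕ)
    (f : ℕ → M) :
    ∑ l ∈ Icc (j + 1) (i + 1), f l = ∑ l ∈ range p, if j ≤ l ∧ l ≤ i then f (l + 1) else 0 := by
  rw [← sum_filter]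
  refine sum_nbij' (fun l => l - 1) (fun l => l + 1) ?_ ?_ ?_ ?_ ?_ <;> intro l hl <;>
    simp only [mem_Icc, mem_filter, mem_range] at hl ⊢
  · omega
  · omega
  · omega
  · omega
  · rw [Nat.sub_add_cancel (by omega)]

open Finset in
/-- If `dB = DB - BC`, where `D` is the shift of `C`, and `β` is the lower triangular array whose
shift is `Bβ`, then `dβ = Cβ - βX` as soon as this holds in the zeroth column, where `X` is
invariant under the shift. -/
lemma derivation_triangular_eq {A : Type*} [Ring A] (d : A →+ A) (p : ℕ) (B C β X : ℕ → ℕ → A)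
    (hLeib : ∀ i l, i < p → ∀ y, d (B i l * y) = d (B i l) * y + B i l * d y)
    (hdB : ∀ i j, i < p →
      d (B i j) = ∑ l ∈ range p, (C (i + 1) (l + 1) * B l j - B i l * C l j))
    (hβ : ∀ i j, i < p → β (i + 1) (j + 1) = ∑ l ∈ range p, B i l * β l j)
    (hβtri : ∀ i j, i < j → β i j = 0) (hCtri : ∀ i j, i ≤ j → C i j = 0)
    (hX : ∀ i j, X (i + 1) (j + 1) = X i j) (hX0 : ∀ j, X 0 j = 0)
    (h0 : ∀ i, i ≤ p → d (β i 0) = ∑ l ∈ range (p + 1), (C i l * β l 0 - β i l * X l 0)) :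
    ∀ j i, i ≤ p → d (β i j) = ∑ l ∈ range (p + 1), (C i l * β l j - β i l * X l j) := by
  intro j
  induction j with
  | zero => exact h0
  | succ j ih =>
    rintro (_ | i) hi
    · rw [hβtri 0 _ (by omega), map_zero]
      refine (sum_eq_zero ?_).symm
      rintro (_ | l) -
      · simp [hCtri, hX0]
      · simp [hCtri, hβtri]
    have hi' : i < p := hi
    have key : ∀ l ∈ range p, d (B i l * β l j) =
        (∑ m ∈ range p, C (i + 1) (m + 1) * (B m l * β l j))
        - (∑ m ∈ range p, B i m * (C m l * β l j))
        + (∑ m ∈ range p, B i l * (C l m * β m j))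
        - (∑ m ∈ range p, B i l * (β l m * X m j)) := by
      intro l hl
      have hl' : l < p := mem_range.mp hl
      rw [hLeib i l hi', hdB i l hi', ih l hl'.le, sum_range_succ, hCtri l p hl'.le, hβtri l p hl']
      simp only [sum_mul, mul_sum, sub_mul, mul_sub, sum_sub_distrib, mul_assoc, zero_mul,
        sub_zero, add_zero]
      abel
    rw [hβ i j hi', map_sum, sum_congr rfl key, sum_range_succ', hβtri 0 (j + 1) (by omega), hX0]
    simp only [sum_add_distrib, sum_sub_distrib, mul_zero, sub_zero, add_zero, hX]
    rw [sum_comm (f := fun l m => B i m * (C m l * β l j)), sub_add_cancel,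
      sum_comm (f := fun l m => C (i + 1) (m + 1) * (B m l * β l j)),
      sum_comm (f := fun l m => B i l * (β l m * X m j))]
    congr 1
    · refine sum_congr rfl fun m hm => ?_
      rw [hβ m j (mem_range.mp hm), mul_sum]
    · refine sum_congr rfl fun m _ => ?_
      rw [hβ i m hi', sum_mul]
      simp only [mul_assoc]

open Finset in
/-- If `dβ = Cβ - βX`, and `dC = e + C²` and `C = βX` in the zeroth column, with `β` even, then
`β (dX - X²) = e` in the zeroth column. -/
lemma derivation_change_of_variables {A : Type*} [Ring A] (d : A →+ A) (p : ℕ)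
    (C β X : ℕ → ℕ → A) (e : ℕ → A)
    (hLeib : ∀ i l, i ≤ p → ∀ y, d (β i l * y) = d (β i l) * y + β i l * d y)
    (hdβ : ∀ i j, i ≤ p → d (β i j) = ∑ l ∈ range (p + 1), (C i l * β l j - β i l * X l j))
    (hC0 : ∀ i, i ≤ p → C i 0 = ∑ l ∈ range (p + 1), β i l * X l 0)
    (hdC : ∀ i, i ≤ p → d (C i 0) = e i + ∑ l ∈ range (p + 1), C i l * C l 0)
    {i : ℕ} (hi : i ≤ p) :
    ∑ l ∈ range (p + 1), β i l * (d (X l 0) - ∑ m ∈ range (p + 1), X l m * X m 0) = e i := by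
  have h1 := hdC i hi
  have hCC : ∑ l ∈ range (p + 1), C i l * C l 0
      = ∑ l ∈ range (p + 1), C i l * ∑ m ∈ range (p + 1), β l m * X m 0 :=
    sum_congr rfl fun l hl => by rw [hC0 l (Nat.lt_succ_iff.mp (mem_range.mp hl))]
  rw [hCC, hC0 i hi, map_sum, sum_congr rfl fun l _ => hLeib i l hi _] at h1
  simp only [hdβ i _ hi, sum_add_distrib, sum_sub_distrib, sub_mul, sum_mul, mul_sum,
    mul_assoc] at h1
  simp only [mul_sub, sum_sub_distrib, mul_sum]
  rw [sum_comm (f := fun l m => C i m * (β m l * X l 0)),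
    sum_comm (f := fun l m => β i m * (X m l * X l 0))] at h1
  rw [sub_add_eq_add_sub, sub_eq_iff_eq_add] at h1
  rw [sub_eq_iff_eq_add]
  have h2 : ∀ s t u v : A, s + t = u + s + v → t = u + v := by
    intro s t u v h
    have : s + t = s + (u + v) := by rw [h]; abel
    exact add_left_cancel this
  exact h2 _ _ _ _ h1


open Finset in
/-- After the change of variables `ā_i = a_i - Σ_{j<i} β_{ij} ā_j`, the generators
satisfy the differential relations of the dga `A_{p,1}`:
`dā_i = -δ_{i,p} + Σ_{j=1}^{i-1} ā_{i-j} ā_j`. -/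
theorem statement_17 {k : Type*} [Field k] [CharZero k]
    {A : Type*} [Ring A] [Algebra k A]
    (A₀ A₁ : Submodule k A)
    (hsup : A₀ ⊔ A₁ = ⊤) (hinf : A₀ ⊓ A₁ = ⊥)
    (hone : (1 : A) ∈ A₀)
    (h00 : ∀ x ∈ A₀, ∀ y ∈ A₀, x * y ∈ A₀)
    (h01 : ∀ x ∈ A₀, ∀ y ∈ A₁, x * y ∈ A₁)
    (h10 : ∀ x ∈ A₁, ∀ y ∈ A₀, x * y ∈ A₁)
    (h11 : ∀ x ∈ A₁, ∀ y ∈ A₁, x * y ∈ A₀)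
    (d : A →ₗ[k] A)
    (hd01 : ∀ x ∈ A₀, d x ∈ A₁) (hd10 : ∀ x ∈ A₁, d x ∈ A₀)
    (hLeib₀ : ∀ x ∈ A₀, ∀ y : A, d (x * y) = d x * y + x * d y)
    (hLeib₁ : ∀ x ∈ A₁, ∀ y : A, d (x * y) = d x * y - x * d y)
    (p : ℕ) (hp : 3 ≤ p)
    (a : ℕ → A) (b c : ℕ → ℕ → A)
    (haodd : ∀ i, 1 ≤ i → i ≤ p → a i ∈ A₁)
    (hbeven : ∀ i j, 1 ≤ j → j < i → i ≤ p → b i j ∈ A₀)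
    (hcodd : ∀ i j, j < i → i ≤ p → c i j ∈ A₁)
    (hbii : ∀ i, b i i = 1) (hcii : ∀ i, c i i = 1)
    (hci0 : ∀ i, 1 ≤ i → c i 0 = a i)
    (hdc : ∀ i j, j < i → i ≤ p →
      d (c i j) = -(if i - j = p then (1 : A) else 0) + ∑ l ∈ Ioo j i, c i l * c l j)
    (hdb : ∀ i j, 1 ≤ j → j < i → i ≤ p →
      d (b i j) = ∑ l ∈ Icc j i, (c i l * b l j - b i l * c (l - 1) (j - 1)))
    (β : ℕ → ℕ → A)
    (hβii : ∀ i, β i i = 1)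
    (hβi0 : ∀ i, 1 ≤ i → β i 0 = 0)
    (hβrec : ∀ i j, 1 ≤ j → j < i → β i j = ∑ l ∈ Icc j i, b i l * β (l - 1) (j - 1))
    (abar : ℕ → A)
    (habar : ∀ i, 1 ≤ i → i ≤ p → abar i = a i - ∑ j ∈ Ico 1 i, β i j * abar j)
    :
    ∀ i, 1 ≤ i → i ≤ p →
      d (abar i) = -(if i = p then (1 : A) else 0) + ∑ j ∈ Ico 1 i, abar (i - j) * abar j := by
  have hd1 : d 1 = 0 := by simpa using hLeib₀ 1 hone 1
  set B : ℕ → ℕ → A := fun i j => if j ≤ i then b (i + 1) (j + 1) else 0 with hB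
  set C : ℕ → ℕ → A := fun i j => if j < i then c i j else 0 with hC
  set β' : ℕ → ℕ → A := fun i j => if j ≤ i then β i j else 0 with hβ'
  set X : ℕ → ℕ → A := fun i j => if j < i then abar (i - j) else 0 with hX
  have hBeven : ∀ i j, i < p → B i j ∈ A₀ := by
    intro i j hi
    rcases lt_trichotomy j i with h | rfl | h
    · simpa [hB, h.le] using hbeven (i + 1) (j + 1) (by omega) (by omega) (by omega)
    · simpa [hB, hbii] using hone
    · simp [hB, h.not_ge]
  have hβ'rec : ∀ i j, i < p → β' (i + 1) (j + 1) = ∑ l ∈ range p, B i l * β' l j := by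
    intro i j hi
    rcases le_or_gt j i with h | h
    · have h1 : β (i + 1) (j + 1)
          = ∑ l ∈ Icc (j + 1) (i + 1), b (i + 1) l * β (l - 1) j := by
        rcases h.lt_or_eq with h | rfl
        · exact hβrec (i + 1) (j + 1) (by omega) (by omega)
        · simp [hβii, hbii]
      simp only [hβ', Nat.add_le_add_iff_right, h, if_true]
      rw [h1, sum_Icc_succ_eq_sum_range_ite hi]
      refine sum_congr rfl fun l _ => ?_
      by_cases h2 : l ≤ i <;> by_cases h3 : j ≤ l <;> simp [hB, h2, h3]
    · rw [sum_eq_zero]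
      · simp [hβ', h.not_ge]
      · intro l _
        by_cases h2 : l ≤ i
        · simp [hβ', show ¬ j ≤ l by omega]
        · simp [hB, h2]
  have hβeven : ∀ j i, i ≤ p → β' i j ∈ A₀ := by
    intro j
    induction j with
    | zero =>
      rintro (_ | i) _
      · simpa [hβ', hβii] using hone
      · simp [hβ', hβi0]
    | succ j ih =>
      rintro (_ | i) hi
      · simp [hβ']
      · rw [hβ'rec i j hi]
        exact sum_mem fun l hl => h00 _ (hBeven i l hi) _ (ih l (mem_range.mp hl).le)
  have hdB : ∀ i j, i < p →
      d (B i j) = ∑ l ∈ range p, (C (i + 1) (l + 1) * B l j - B i l * C l j) := by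
    intro i j hi
    rcases lt_or_ge j i with h | h
    · have h1 := hdb (i + 1) (j + 1) (by omega) (by omega) (by omega)
      rw [sum_Icc_succ_eq_sum_range_ite hi] at h1
      have h2 : ∀ l ∈ range p, (if j ≤ l ∧ l ≤ i then
          c (i + 1) (l + 1) * b (l + 1) (j + 1)
            - b (i + 1) (l + 1) * c (l + 1 - 1) (j + 1 - 1) else 0)
          = (C (i + 1) (l + 1) * B l j - B i l * C l j)
            + ((if l = i then B i j else 0) - (if l = j then B i j else 0)) := by
        intro l _
        rcases lt_trichotomy l i with h3 | rfl | h3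
        · rcases lt_trichotomy l j with h4 | rfl | h4
          · simp [hB, hC, h4.not_ge, h4.not_gt, h4.ne, h3.ne]
          · simp [hB, hC, hbii, hcii, h3.le, h3, h3.ne]
            exact sub_eq_add_neg _ _
          · simp [hB, hC, h3.le, h3, h3.ne, h4.le, h4, h4.ne']
        · simp [hB, hC, hbii, hcii, h, h.le, h.ne']
          exact sub_eq_neg_add _ _
        · simp [hB, hC, h3.not_ge, h3.not_gt, h3.ne', (h.trans h3).ne']
      rw [sum_congr rfl h2, sum_add_distrib, sum_sub_distrib (f := fun l => ite (l = i) _ _),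
        sum_ite_eq', sum_ite_eq', if_pos (mem_range.mpr hi),
        if_pos (mem_range.mpr (h.trans hi)), sub_self, add_zero] at h1
      simpa only [hB, h.le, if_true] using h1
    · rw [sum_eq_zero]
      · rcases h.lt_or_eq with h | rfl
        · simp [hB, h.not_ge]
        · simp [hB, hbii, hd1]
      · intro l _
        by_cases h2 : l < i
        · simp [hB, hC, show ¬ j ≤ l by omega, show ¬ j < l by omega]
        · rcases (not_lt.mp h2).lt_or_eq with h3 | rfl
          · simp [hB, hC, h2, h3.not_ge]
          · simp [hC, h.not_gt]
  have hC0 : ∀ i, i ≤ p → C i 0 = ∑ l ∈ range (p + 1), β' i l * X l 0 := by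
    rintro (_ | i) hi
    · rw [sum_eq_zero]
      · simp [hC]
      · rintro (_ | l) _ <;> simp [hX, hβ']
    · have h1 := habar (i + 1) (by omega) hi
      rw [eq_sub_iff_add_eq, add_comm] at h1
      have h2 : ∑ l ∈ Ico 1 (i + 1 + 1), β (i + 1) l * abar l = a (i + 1) := by
        rw [sum_Ico_succ_top (by omega), hβii, one_mul, h1]
      rw [show C (i + 1) 0 = a (i + 1) by simp [hC, hci0], ← h2]
      refine sum_subset_zero_on_sdiff ?_ ?_ ?_
      · intro l hl
        simp only [mem_Ico, mem_range] at hl ⊢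
        omega
      · intro l hl
        simp only [mem_sdiff, mem_Ico, mem_range, not_and] at hl
        by_cases h3 : 0 < l
        · simp [hβ', show ¬ l ≤ i + 1 by omega]
        · simp [hX, h3]
      · intro l hl
        simp only [mem_Ico] at hl
        simp [hβ', hX, show l ≤ i + 1 by omega, show 0 < l by omega]
  have hdC : ∀ i, i ≤ p → d (C i 0) = -(if i = p then (1 : A) else 0)
      + ∑ l ∈ range (p + 1), C i l * C l 0 := by
    rintro (_ | i) hi
    · simp [hC, show 0 ≠ p by omega]
    · have h1 := hdc (i + 1) 0 (by omega) hi
      rw [Nat.sub_zero] at h1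
      rw [show C (i + 1) 0 = c (i + 1) 0 by simp [hC], h1]
      congr 1
      refine sum_subset_zero_on_sdiff ?_ ?_ ?_
      · intro l hl
        simp only [mem_Ioo, mem_range] at hl ⊢
        omega
      · intro l hl
        simp only [mem_sdiff, mem_Ioo, mem_range, not_and] at hl
        by_cases h3 : 0 < l
        · simp [hC, show ¬ l < i + 1 by omega]
        · simp [hC, h3]
      · intro l hl
        simp only [mem_Ioo] at hl
        simp [hC, hl.1, hl.2]
  have hdβ := derivation_triangular_eq d.toAddMonoidHom p B C β' X
    (fun i l hi y => hLeib₀ _ (hBeven i l hi) y) hdB hβ'rec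
    (fun i j h => by simp [hβ', h.not_ge]) (fun i j h => by simp [hC, h.not_gt])
    (fun i j => by simp [hX]) (fun j => by simp [hX]) (by
      intro i hi
      rw [sum_sub_distrib, ← hC0 i hi, sum_range_succ', sum_eq_zero]
      · rcases i with _ | i <;> simp [hβ', hC, hβii, hβi0, hd1]
      · intro l _
        simp [hβ', hβi0])
  have hsol : ∀ i, i ≤ p → d (X i 0) - ∑ m ∈ range (p + 1), X i m * X m 0
      = -(if i = p then (1 : A) else 0) := by
    intro i
    induction i using Nat.strong_induction_on with
    | _ i ih =>
      intro hi
      have h1 := derivation_change_of_variables d.toAddMonoidHom p C β' X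
        (fun i => -(if i = p then (1 : A) else 0))
        (fun i l hi y => hLeib₀ _ (hβeven l i hi) y) (fun i j hi => hdβ j i hi) hC0 hdC hi
      rw [sum_eq_single i] at h1
      · simpa [hβ', hβii] using h1
      · intro l _ hl
        rcases hl.lt_or_gt with h | h
        · exact (congrArg (β' i l * ·) (ih l h (by omega))).trans
            (by simp [show l ≠ p by omega])
        · simp [hβ', h.not_ge]
      · intro h
        exact absurd (mem_range.mpr (by omega)) h
  intro i hi hip
  have h1 := sub_eq_iff_eq_add.mp (hsol i hip)
  rw [show X i 0 = abar i by simp [hX, show 0 < i by omega]] at h1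
  rw [h1]
  congr 1
  refine (sum_subset_zero_on_sdiff ?_ ?_ ?_).symm
  · intro l hl
    simp only [mem_Ico, mem_range] at hl ⊢
    omega
  · intro l hl
    simp only [mem_sdiff, mem_Ico, mem_range, not_and] at hl
    by_cases h3 : 0 < l
    · simp [hX, show ¬ l < i by omega]
    · simp [hX, h3]
  · intro l hl
    simp only [mem_Ico] at hl
    simp [hX, hl.2, show 0 < l by omega]
end

section
/- Let k be a field of characteristic zero, A a ℤ/2-graded associative unital k-algebra, and d : A → A a k-linear map of odd degree satisfying the graded Leibniz rule d(xy) = (dx)y + (−1)^r x(dy) for x homogeneous of degree r. Fix an integer p ≥ 3 and elements aᵢ ∈ A odd (1 ≤ i ≤ p), b_{ij} ∈ A even (p ≥ i > j ≥ 1), c_{ij} ∈ A odd (p ≥ i > j ≥ 1), and c'_{ij} ∈ A odd (p ≥ i, j ≥ 1), with the conventions b_{ii} := 1, c_{ii} := 1 for all i ≥ 0, and c_{i0} := aᵢ for i ≥ 1. Assume d c_{ij} = −δ_{i−j,p}·1 + Σ_{k=j+1}^{i−1} c_{ik} c_{kj} for p ≥ i > j ≥ 0, d b_{ij} = Σ_{k=j}^{i}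 ( c_{ik} b_{kj} − b_{ik} c_{(k−1)(j−1)} ) for p ≥ i > j ≥ 1, and d c'_{ij} = δ_{ij}·1 + Σ_{k=1}^{i−1} c_{ik} c'_{kj} + Σ_{k=j+1}^{p} c'_{ik} c_{kj} for p ≥ i, j ≥ 1. Define β_{ii} := 1, β_{i0} := 0 for i > 0, β_{ij} := Σ_{k=j}^{i} b_{ik} β_{(k−1)(j−1)} for i > j ≥ 1; ā_i := aᵢ − Σ_{j=1}^{i−1} β_{ij} ā_j; and recursively in i, c̄'_{ij} := c'_{ij} − Σ_{k=1}^{i−1} β_{ik} c̄'_{kj} + Σ_{k=j+1}^{p} c'_{ik} β_{kj}. Then for all p ≥ i, j ≥ 1: d c̄'_{ij} = δ_{ij}·1 + Σ_{k=1}^{i−1} ā_{i−k} c̄'_{kj} + Σ_{k=j+1}^{p} c̄'_{ik} ā_{k−j}. -/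
namespace Matrix

/-- The Leibniz rule for the entrywise action of an odd derivation on a product whose left factor
has even entries. -/
theorem map_mul_of_even {A m n o : Type*} [Ring A] [Fintype n] (d : A →+ A) (S : Set A)
    (hd : ∀ x ∈ S, ∀ y, d (x * y) = d x * y + x * d y)
    (M : Matrix m n A) (N : Matrix n o A) (hM : ∀ i j, M i j ∈ S) :
    (M * N).map d = M.map d * N + M * N.map d := by
  ext i j
  simp only [map_apply, mul_apply, add_apply, map_sum, ← Finset.sum_add_distrib]
  exact Finset.sum_congr rfl fun l _ => hd _ (hM i l) _

/-- The Leibniz rule for the entrywise action of an odd derivation on a product whose left factor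
has odd entries. -/
theorem map_mul_of_odd {A m n o : Type*} [Ring A] [Fintype n] (d : A →+ A) (S : Set A)
    (hd : ∀ x ∈ S, ∀ y, d (x * y) = d x * y - x * d y)
    (M : Matrix m n A) (N : Matrix n o A) (hM : ∀ i j, M i j ∈ S) :
    (M * N).map d = M.map d * N - M * N.map d := by
  ext i j
  simp only [map_apply, mul_apply, sub_apply, map_sum, ← Finset.sum_sub_distrib]
  exact Finset.sum_congr rfl fun l _ => hd _ (hM i l) _

/-- A lower unitriangular matrix over a (possibly noncommutative) ring is left cancellable. -/
theorem eq_zero_of_lower_unitriangular_mul {A n o : Type*} [Ring A] [Fintype n] [LinearOrder n]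
    (M : Matrix n n A) (Z : Matrix n o A) (hdiag : ∀ i, M i i = 1)
    (hupper : ∀ i j, i < j → M i j = 0) (h : M * Z = 0) : Z = 0 := by
  ext i j
  induction i using WellFoundedLT.induction with
  | ind i ih =>
    have hi : (M * Z) i j = 0 := by rw [h]; rfl
    rw [mul_apply, Finset.sum_eq_single i] at hi
    · simpa [hdiag] using hi
    · intro l _ hl
      rcases lt_or_gt_of_ne hl with hl | hl
      · rw [ih l hl, zero_apply, mul_zero]
      · rw [hupper i l hl, zero_mul]
    · simp

end Matrix

namespace Finset

/-- Reindexing a sum over a subset of `{1, …, p}` by `Fin p`. -/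
theorem sum_eq_sum_fin_succ {A : Type*} [AddCommMonoid A] {p : ℕ} (s : Finset ℕ)
    (hs : ∀ l ∈ s, 1 ≤ l ∧ l ≤ p) (f : ℕ → A) :
    ∑ l ∈ s, f l = ∑ l : Fin p, if (l : ℕ) + 1 ∈ s then f (l + 1) else 0 := by
  rw [Fin.sum_univ_eq_sum_range (fun l => if l + 1 ∈ s then f (l + 1) else 0) p, ← sum_filter]
  symm
  refine sum_nbij (· + 1) ?_ ?_ ?_ ?_
  · intro l hl; exact (mem_filter.1 hl).2
  · intro x _ y _ h; simpa using h
  · intro l hl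
    have := hs l hl
    refine ⟨l - 1, ?_, by simp; omega⟩
    simp only [coe_filter, mem_range, Set.mem_ofPred_eq]
    have : l - 1 + 1 = l := by omega
    exact ⟨by omega, by rwa [this]⟩
  · intros; rfl

/-- Shifting the index of a sum over `Fin p` whose two extreme terms vanish. -/
theorem sum_fin_succ_eq {A : Type*} [AddCommMonoid A] {p : ℕ} (f : ℕ → A)
    (h0 : f 0 = 0) (hp : f p = 0) : ∑ l : Fin p, f (l + 1) = ∑ l : Fin p, f l := by
  rw [Fin.sum_univ_eq_sum_range (fun l => f (l + 1)) p, Fin.sum_univ_eq_sum_range f p]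
  have h := (sum_range_succ f p).symm.trans (sum_range_succ' f p)
  simpa [h0, hp] using h.symm

end Finset

open Finset in
/-- After the change of variables `c̄'_{ij}`, the generators satisfy the differential
relations `dy_{ij} = δ_{ij} + Σ_k x_{i-k} y_{kj} + Σ_k y_{ik} x_{k-j}` of the dga
`A_{p,1}`, completing the stable tame isomorphism `CE*(Λ_{p,1}) ≅ A_{p,1}`. -/
theorem statement_18 {k : Type*} [Field k] [CharZero k]
    {A : Type*} [Ring A] [Algebra k A]
    (A₀ A₁ : Submodule k A)
    (hsup : A₀ ⊔ A₁ = ⊤) (hinf : A₀ ⊓ A₁ = ⊥)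
    (hone : (1 : A) ∈ A₀)
    (h00 : ∀ x ∈ A₀, ∀ y ∈ A₀, x * y ∈ A₀)
    (h01 : ∀ x ∈ A₀, ∀ y ∈ A₁, x * y ∈ A₁)
    (h10 : ∀ x ∈ A₁, ∀ y ∈ A₀, x * y ∈ A₁)
    (h11 : ∀ x ∈ A₁, ∀ y ∈ A₁, x * y ∈ A₀)
    (d : A →ₗ[k] A)
    (hd01 : ∀ x ∈ A₀, d x ∈ A₁) (hd10 : ∀ x ∈ A₁, d x ∈ A₀)
    (hLeib₀ : ∀ x ∈ A₀, ∀ y : A, d (x * y) = d x * y + x * d y)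
    (hLeib₁ : ∀ x ∈ A₁, ∀ y : A, d (x * y) = d x * y - x * d y)
    (p : ℕ) (hp : 3 ≤ p)
    (a : ℕ → A) (b c : ℕ → ℕ → A)
    (haodd : ∀ i, 1 ≤ i → i ≤ p → a i ∈ A₁)
    (hbeven : ∀ i j, 1 ≤ j → j < i → i ≤ p → b i j ∈ A₀)
    (hcodd : ∀ i j, j < i → i ≤ p → c i j ∈ A₁)
    (hbii : ∀ i, b i i = 1) (hcii : ∀ i, c i i = 1)
    (hci0 : ∀ i, 1 ≤ i → c i 0 = a i)
    (hdc : ∀ i j, j < i → i ≤ p →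
      d (c i j) = -(if i - j = p then (1 : A) else 0) + ∑ l ∈ Ioo j i, c i l * c l j)
    (hdb : ∀ i j, 1 ≤ j → j < i → i ≤ p →
      d (b i j) = ∑ l ∈ Icc j i, (c i l * b l j - b i l * c (l - 1) (j - 1)))
    (β : ℕ → ℕ → A)
    (hβii : ∀ i, β i i = 1)
    (hβi0 : ∀ i, 1 ≤ i → β i 0 = 0)
    (hβrec : ∀ i j, 1 ≤ j → j < i → β i j = ∑ l ∈ Icc j i, b i l * β (l - 1) (j - 1))
    (abar : ℕ → A)
    (habar : ∀ i, 1 ≤ i → i ≤ p → abar i = a i - ∑ j ∈ Ico 1 i, β i j * abar j)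
    (c' : ℕ → ℕ → A)
    (hc'odd : ∀ i j, 1 ≤ i → i ≤ p → 1 ≤ j → j ≤ p → c' i j ∈ A₁)
    (hdc' : ∀ i j, 1 ≤ i → i ≤ p → 1 ≤ j → j ≤ p →
      d (c' i j) = (if i = j then (1 : A) else 0) + ∑ l ∈ Ico 1 i, c i l * c' l j +
        ∑ l ∈ Icc (j + 1) p, c' i l * c l j)
    (cbar' : ℕ → ℕ → A)
    (hcbar' : ∀ i j, 1 ≤ i → i ≤ p → 1 ≤ j → j ≤ p →
      cbar' i j = c' i j - ∑ l ∈ Ico 1 i, β i l * cbar' l j +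
        ∑ l ∈ Icc (j + 1) p, c' i l * β l j) :
    ∀ i j, 1 ≤ i → i ≤ p → 1 ≤ j → j ≤ p →
      d (cbar' i j) = (if i = j then (1 : A) else 0) +
        ∑ l ∈ Ico 1 i, abar (i - l) * cbar' l j +
        ∑ l ∈ Icc (j + 1) p, cbar' i l * abar (l - j) := by
  have hd1 : d 1 = 0 := by simpa using hLeib₀ 1 hone 1
  let C : ℕ → ℕ → A := fun i j => if j < i then c i j else 0
  let B : ℕ → ℕ → A := fun i j => if j ≤ i then b i j else 0
  let T : ℕ → ℕ → A := fun i j => if j ≤ i then β i j else 0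
  let X : ℕ → ℕ → A := fun i j => if j < i then abar (i - j) else 0
  have hB : ∀ i j, i ≤ p → 1 ≤ j → B i j ∈ A₀ := by
    intro i j hi hj
    simp only [B]
    split_ifs with h
    · rcases h.eq_or_lt with rfl | h
      · rw [hbii]; exact hone
      · exact hbeven i j hj h hi
    · exact zero_mem _
  have hTmul : ∀ i j, i < p → T (i + 1) (j + 1) = ∑ l : Fin p, B (i + 1) (l + 1) * T l j := by
    intro i j hi
    simp only [T, B]
    rcases lt_trichotomy i j with h | rfl | h
    · rw [if_neg (by omega), Finset.sum_eq_zero]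
      intro l _
      split_ifs <;> first | omega | simp
    · rw [if_pos le_rfl, hβii, Finset.sum_eq_single ⟨i, hi⟩]
      · simp [hbii, hβii]
      · intro l _ hl
        have : (l : ℕ) ≠ i := fun h => hl (Fin.ext h)
        split_ifs <;> first | omega | simp
      · simp
    · rw [if_pos (by omega), hβrec _ _ (by omega) (by omega),
        Finset.sum_eq_sum_fin_succ (p := p) _ (by intro l; simp; omega)]
      refine Finset.sum_congr rfl fun l _ => ?_
      simp only [Finset.mem_Icc, Nat.add_sub_cancel]
      split_ifs <;> first | omega | simp
  have hT : ∀ j i, i ≤ p → T i j ∈ A₀ := by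
    intro j
    induction j with
    | zero =>
      intro i _
      rcases Nat.eq_zero_or_pos i with rfl | h
      · simpa [T, hβii] using hone
      · simp [T, hβi0 i h]
    | succ j ih =>
      intro i hi
      rcases i with _ | i
      · simp [T]
      · rw [hTmul i j hi]
        exact Submodule.sum_mem _ fun l _ =>
          h00 _ (hB _ _ hi (by omega)) _ (ih l l.2.le)
  have hdB : ∀ i j, i < p → d (B (i + 1) (j + 1)) =
      ∑ l : Fin p, (C (i + 1) (l + 1) * B (l + 1) (j + 1) - B (i + 1) (l + 1) * C l j) := by
    intro i j hi
    simp only [B, C]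
    rcases le_or_gt i j with h | h
    · rw [Finset.sum_eq_zero]
      · rcases h.eq_or_lt with rfl | h
        · simp [hbii, hd1]
        · rw [if_neg (by omega), map_zero]
      · intro l _
        split_ifs <;> first | omega | simp
    · have key : ∀ f g : ℕ → A, f (i + 1) = b (i + 1) (j + 1) → g (j + 1) = b (i + 1) (j + 1) →
          ∑ l ∈ Finset.Icc (j + 1) (i + 1), (f l - g l) =
          ∑ l : Fin p, ((if j ≤ l ∧ (l : ℕ) < i then f (l + 1) else 0) -
            (if j < l ∧ (l : ℕ) ≤ i then g (l + 1) else 0)) := by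
        intro f g hf hg
        rw [Finset.sum_sub_distrib, Finset.sum_sub_distrib]
        rw [← Finset.sum_Ico_add_eq_sum_Icc (by omega), hf,
          ← Finset.sum_Ioc_add_eq_sum_Icc (by omega), hg, add_sub_add_right_eq_sub,
          Finset.sum_eq_sum_fin_succ (p := p) (Finset.Ico _ _) (by intro l; simp; omega),
          Finset.sum_eq_sum_fin_succ (p := p) (Finset.Ioc _ _) (by intro l; simp; omega)]
        simp
      rw [if_pos (by omega), hdb _ _ (by omega) (by omega) (by omega),
        key (fun l => c (i + 1) l * b l (j + 1)) (fun l => b (i + 1) l * c (l - 1) (j + 1 - 1))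
          (by simp [hcii]) (by simp [hcii])]
      refine Finset.sum_congr rfl fun l _ => ?_
      simp only [Nat.add_sub_cancel]
      split_ifs <;> first | omega | simp
  have hdT_zero : ∀ i < p, d (T i 0) = ∑ l : Fin p, (C i l * T l 0 - T i l * X l 0) := by
    intro i hi
    have hp0 : 0 < p := by omega
    have hC : ∑ l : Fin p, C i l * T l 0 = C i 0 := by
      rw [Finset.sum_eq_single ⟨0, hp0⟩]
      · simp [T, hβii]
      · intro l _ hl
        have : (l : ℕ) ≠ 0 := fun h => hl (Fin.ext h)
        simp [T, hβi0 l (by omega)]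
      · simp
    rw [Finset.sum_sub_distrib, hC]
    rcases Nat.eq_zero_or_pos i with rfl | h
    · rw [Finset.sum_eq_zero]
      · simp [T, C, hβii, hd1]
      · intro l _
        simp only [T, X]
        split_ifs <;> first | omega | simp
    · have hs : ∑ l : Fin p, T i l * X l 0 = a i := by
        have ha : a i = ∑ j ∈ Finset.Icc 1 i, β i j * abar j := by
          rw [← Finset.sum_Ico_add_eq_sum_Icc h, hβii, one_mul, habar i h hi.le]
          abel
        rw [ha, Finset.sum_eq_sum_fin_succ (p := p) _ (by intro l; simp; omega),
          ← Finset.sum_fin_succ_eq (fun l => T i l * X l 0) (by simp [X])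
            (by simp [T, Nat.not_le.2 hi])]
        refine Finset.sum_congr rfl fun l _ => ?_
        simp only [T, X, Finset.mem_Icc]
        split_ifs <;> first | omega | simp
      rw [hs]
      simp [T, C, hβi0 i h, h, hci0 i h]
  have hdT_succ : ∀ j, (∀ i < p, d (T i j) = ∑ l : Fin p, (C i l * T l j - T i l * X l j)) →
      ∀ i < p, d (T (i + 1) (j + 1)) = ∑ l : Fin p,
        (C (i + 1) (l + 1) * T (l + 1) (j + 1) - T (i + 1) (l + 1) * X (l + 1) (j + 1)) := by
    intro j hj i hi
    let B₁ : Matrix (Fin p) (Fin p) A := .of fun i l => B (i + 1) (l + 1)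
    let C₁ : Matrix (Fin p) (Fin p) A := .of fun i l => C (i + 1) (l + 1)
    let T₁ : Matrix (Fin p) (Fin p) A := .of fun i l => T (i + 1) (l + 1)
    let C₀ : Matrix (Fin p) (Fin p) A := .of fun i l => C i l
    let T₀ : Matrix (Fin p) (Fin p) A := .of fun i l => T i l
    let t : Matrix (Fin p) Unit A := .of fun i _ => T i j
    let t₁ : Matrix (Fin p) Unit A := .of fun i _ => T (i + 1) (j + 1)
    let x : Matrix (Fin p) Unit A := .of fun i _ => X i j
    have hBT : B₁ * T₀ = T₁ := by
      ext i l
      exact (hTmul i l i.2).symm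
    have hBt : B₁ * t = t₁ := by
      ext i l
      exact (hTmul i j i.2).symm
    have hdt : t.map d = C₀ * t - T₀ * x := by
      ext i l
      simpa [Matrix.mul_apply, t, C₀, T₀, x, ← Finset.sum_sub_distrib] using hj i i.2
    have hdB₁ : B₁.map d = C₁ * B₁ - B₁ * C₀ := by
      ext i l
      simpa [Matrix.mul_apply, B₁, C₁, C₀, ← Finset.sum_sub_distrib] using hdB i l i.2
    have hmul := Matrix.map_mul_of_even d.toAddMonoidHom A₀ hLeib₀ B₁ t
      fun i l => hB _ _ i.2 (by omega)
    have hmain : t₁.map d = C₁ * t₁ - T₁ * x := by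
      rw [← hBt, ← hBT]
      refine hmul.trans ?_
      change B₁.map d * t + B₁ * t.map d = _
      rw [hdt, hdB₁, Matrix.sub_mul, Matrix.mul_sub]
      simp only [Matrix.mul_assoc]
      abel
    have h := congrFun (congrFun hmain ⟨i, hi⟩) ()
    simpa [Matrix.mul_apply, t₁, C₁, T₁, x, X, ← Finset.sum_sub_distrib] using h
  have hdT : ∀ j, ∀ i < p, d (T i j) = ∑ l : Fin p, (C i l * T l j - T i l * X l j) := by
    intro j
    induction j with
    | zero => exact hdT_zero
    | succ j ih =>
      intro i hi
      rcases i with _ | i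
      · rw [Finset.sum_eq_zero]
        · simp [T]
        · intro l _
          simp only [T, C, X]
          split_ifs <;> first | omega | simp
      · rw [hdT_succ j ih i (by omega)]
        refine Finset.sum_fin_succ_eq
          (fun l => C (i + 1) l * T l (j + 1) - T (i + 1) l * X l (j + 1)) ?_ ?_
        · simp [T, X]
        · simp [T, C, Nat.not_le.2 hi, Nat.not_lt.2 hi.le]
  let C₁ : Matrix (Fin p) (Fin p) A := .of fun i l => C (i + 1) (l + 1)
  let T₁ : Matrix (Fin p) (Fin p) A := .of fun i l => T (i + 1) (l + 1)
  let X₁ : Matrix (Fin p) (Fin p) A := .of fun i l => X (i + 1) (l + 1)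
  let Y : Matrix (Fin p) (Fin p) A := .of fun i l => c' (i + 1) (l + 1)
  let Z : Matrix (Fin p) (Fin p) A := .of fun i l => cbar' (i + 1) (l + 1)
  have hdT₁ : T₁.map d = C₁ * T₁ - T₁ * X₁ := by
    ext i j
    simpa [Matrix.mul_apply, T₁, C₁, X₁, ← Finset.sum_sub_distrib] using
      hdT_succ j (hdT j) i i.2
  have hleft : ∀ (g : ℕ → A) (f : ℕ → ℕ → A) (i : Fin p),
      ∑ l ∈ Finset.Ico 1 ((i : ℕ) + 1), f (i + 1) l * g l =
        ∑ l : Fin p, (if (l : ℕ) + 1 < i + 1 then f (i + 1) (l + 1) else 0) * g (l + 1) := by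
    intro g f i
    rw [Finset.sum_eq_sum_fin_succ (p := p) _ (by intro l; simp; omega)]
    simp
  have hright : ∀ (g : ℕ → A) (f : ℕ → ℕ → A) (j : Fin p),
      ∑ l ∈ Finset.Icc ((j : ℕ) + 1 + 1) p, g l * f l (j + 1) =
        ∑ l : Fin p, g (l + 1) * (if (j : ℕ) + 1 < l + 1 then f (l + 1) (j + 1) else 0) := by
    intro g f j
    rw [Finset.sum_eq_sum_fin_succ (p := p) _ (by intro l; simp; omega)]
    refine Finset.sum_congr rfl fun l _ => ?_
    simp only [Finset.mem_Icc]
    split_ifs <;> first | omega | simp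
  have hone_apply : ∀ i j : Fin p, (1 : Matrix (Fin p) (Fin p) A) i j =
      if (i : ℕ) + 1 = j + 1 then 1 else 0 := by
    intro i j
    simp [Matrix.one_apply, Fin.ext_iff]
  have hdY : Y.map d = 1 + C₁ * Y + Y * C₁ := by
    ext i j
    have h := hdc' (i + 1) (j + 1) (by omega) (by omega) (by omega) (by omega)
    rw [hleft (fun l => c' l (j + 1)) c i, hright (fun l => c' (i + 1) l) c j, ← hone_apply] at h
    exact h
  have hT₁ : ∀ i j : Fin p, (T₁ - 1) i j =
      if (j : ℕ) + 1 < i + 1 then β (i + 1) (j + 1) else 0 := by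
    intro i j
    rw [Matrix.sub_apply, hone_apply]
    simp only [T₁, T, Matrix.of_apply]
    rcases lt_trichotomy (i : ℕ) j with h | h | h
    · rw [if_neg (by omega), if_neg (by omega), if_neg (by omega), sub_zero]
    · simp [h, hβii]
    · simp [h, h.ne', h.le]
  have hTZ : T₁ * Z = Y * T₁ := by
    have h : Z = Y - (T₁ - 1) * Z + Y * (T₁ - 1) := by
      ext i j
      have h := hcbar' (i + 1) (j + 1) (by omega) (by omega) (by omega) (by omega)
      rw [hleft (fun l => cbar' l (j + 1)) β i, hright (fun l => c' (i + 1) l) β j] at h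
      rw [Matrix.add_apply, Matrix.sub_apply, Matrix.mul_apply, Matrix.mul_apply]
      simp only [hT₁]
      exact h
    rw [sub_mul, mul_sub, one_mul, mul_one] at h
    rw [← sub_eq_zero] at h ⊢
    rw [← h]
    abel
  have hL := Matrix.map_mul_of_even d.toAddMonoidHom A₀ hLeib₀ T₁ Z fun i l => hT _ _ i.2
  have hR := Matrix.map_mul_of_odd d.toAddMonoidHom A₁ hLeib₁ Y T₁
    fun i l => hc'odd _ _ (by omega) i.2 (by omega) l.2
  have hLR : T₁.map d * Z + T₁ * Z.map d = Y.map d * T₁ - Y * T₁.map d := by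
    rw [hTZ] at hL
    exact hL.symm.trans hR
  have hzero : T₁ * (Z.map d - (1 + X₁ * Z + Z * X₁)) = 0 := by
    have h : T₁ * Z.map d = Y.map d * T₁ - Y * T₁.map d - T₁.map d * Z := by
      rw [← hLR]; abel
    rw [mul_sub, h, hdT₁, hdY]
    simp only [add_mul, mul_add, sub_mul, mul_sub, mul_one, one_mul, ← mul_assoc, hTZ]
    simp only [mul_assoc, hTZ]
    abel
  have hZ := Matrix.eq_zero_of_lower_unitriangular_mul T₁ _
    (by intro i; simp [T₁, T, hβii]) (by
      intro i j h
      simp [T₁, T, h.not_ge]) hzero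
  rw [sub_eq_zero] at hZ
  intro i j hi hip hj hjp
  obtain ⟨i, rfl⟩ : ∃ i', i = i' + 1 := ⟨i - 1, by omega⟩
  obtain ⟨j, rfl⟩ : ∃ j', j = j' + 1 := ⟨j - 1, by omega⟩
  have h := congrFun (congrFun hZ ⟨i, hip⟩) ⟨j, hjp⟩
  rw [hleft (fun l => cbar' l (j + 1)) (fun i l => abar (i - l)) ⟨i, hip⟩,
    hright (fun l => cbar' (i + 1) l) (fun l j => abar (l - j)) ⟨j, hjp⟩]
  rw [Matrix.add_apply, Matrix.add_apply, hone_apply] at h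
  exact h
end
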